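/- arXiv:2401.14008 — 2 statements merged into one kernel-verified Lean document; each statement's English description precedes it below -/
import Mathlib

section
/- Let N, M, J, P, R be positive natural numbers, let A ∈ ℂ^{N×J} and B ∈ ℂ^{M×P}, and let 0 ≤ ε < 1. Suppose A and B satisfy the RIP of order 2R with constant ε. Let X, X̂ ∈ ℂ^{J×P} each have at most R nonzero entries, let σ ≥ 0 and let W ∈ ℂ^{N×M} satisfy ‖W‖_F ≤ √(N·M)·σ. Set Y = A X Bᵀ + W and R̃ = Y − A X̂ Bᵀ. If ‖R̃‖_F ≤ τ for some τ ≥ 0, then ‖X̂ − X‖_F ≤ (τ + √(N·M)·σ)/√(1 − ε). -/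
open scoped BigOperators

/-- Frobenius norm of a complex matrix. -/
noncomputable def frob {m n : Type*} [Fintype m] [Fintype n] (X : Matrix m n ℂ) : ℝ :=
  Real.sqrt (∑ i, ∑ j, ‖X i j‖ ^ 2)

/-- `X` has at most `r` nonzero entries. -/
def sparseLE {J P : ℕ} (X : Matrix (Fin J) (Fin P) ℂ) (r : ℕ) : Prop :=
  {p : Fin J × Fin P | X p.1 p.2 ≠ 0}.ncard ≤ r

theorem frob_sub_le_aux {m n : Type*} [Fintype m] [Fintype n] (X Y : Matrix m n ℂ) :
    frob (X - Y) ≤ frob X + frob Y := by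
  letI := @Matrix.frobeniusNormedAddCommGroup m n ℂ _ _ _
  have h : ∀ Z : Matrix m n ℂ, frob Z = ‖Z‖ := by
    intro Z
    rw [Matrix.frobenius_norm_def, frob, Real.sqrt_eq_rpow]
    simp
  rw [h, h, h]
  exact norm_sub_le X Y

theorem sparse_sub_aux {J P R : ℕ} {X Y : Matrix (Fin J) (Fin P) ℂ}
    (hX : sparseLE X R) (hY : sparseLE Y R) : sparseLE (X - Y) (2 * R) := by
  unfold sparseLE at *
  have hsub : {p : Fin J × Fin P | (X - Y) p.1 p.2 ≠ 0} ⊆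
      {p : Fin J × Fin P | X p.1 p.2 ≠ 0} ∪ {p : Fin J × Fin P | Y p.1 p.2 ≠ 0} := by
    intro p hp
    by_contra hc
    simp only [Set.mem_union, Set.mem_setOf_eq, not_or, not_not] at hc
    apply hp
    simp [hc.1, hc.2]
  have h1 := Set.ncard_le_ncard hsub (Set.toFinite _)
  have h2 := Set.ncard_union_le {p : Fin J × Fin P | X p.1 p.2 ≠ 0}
    {p : Fin J × Fin P | Y p.1 p.2 ≠ 0}
  omega

theorem stmt_0 {N M J P R : ℕ} (hN : 0 < N) (hM : 0 < M) (hJ : 0 < J) (hP : 0 < P)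
    (hR : 0 < R)
    (A : Matrix (Fin N) (Fin J) ℂ) (B : Matrix (Fin M) (Fin P) ℂ)
    (ε : ℝ) (hε0 : 0 ≤ ε) (hε1 : ε < 1)
    (hRIP : ∀ Z : Matrix (Fin J) (Fin P) ℂ, sparseLE Z (2 * R) →
      (1 - ε) * frob Z ^ 2 ≤ frob (A * Z * B.transpose) ^ 2 ∧
        frob (A * Z * B.transpose) ^ 2 ≤ (1 + ε) * frob Z ^ 2)
    (X Xhat : Matrix (Fin J) (Fin P) ℂ)
    (hX : sparseLE X R) (hXhat : sparseLE Xhat R)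
    (σ : ℝ) (hσ : 0 ≤ σ)
    (W : Matrix (Fin N) (Fin M) ℂ)
    (hW : frob W ≤ Real.sqrt (N * M) * σ)
    (Y : Matrix (Fin N) (Fin M) ℂ) (hY : Y = A * X * B.transpose + W)
    (τ : ℝ) (hτ : 0 ≤ τ)
    (hres : frob (Y - A * Xhat * B.transpose) ≤ τ) :
    frob (Xhat - X) ≤ (τ + Real.sqrt (N * M) * σ) / Real.sqrt (1 - ε) := by
  have h1 := (hRIP (Xhat - X) (sparse_sub_aux hXhat hX)).1
  have heq : A * (Xhat - X) * B.transpose = W - (Y - A * Xhat * B.transpose) := by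
    rw [hY, Matrix.mul_sub, Matrix.sub_mul]
    abel
  have h2 := frob_sub_le_aux W (Y - A * Xhat * B.transpose)
  rw [← heq] at h2
  have hpos : 0 < 1 - ε := by linarith
  rw [le_div_iff₀ (Real.sqrt_pos.mpr hpos)]
  have h0 : 0 ≤ frob (A * (Xhat - X) * B.transpose) := Real.sqrt_nonneg _
  have h3 : frob (Xhat - X) * Real.sqrt (1 - ε) ≤ frob (A * (Xhat - X) * B.transpose) := by
    refine abs_le_of_sq_le_sq' ?_ h0 |>.2
    rw [mul_pow, Real.sq_sqrt hpos.le]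
    linarith
  linarith
end

section
/- Let M be a positive natural number and let c ∈ ℝ. Define the matrix B̄ ∈ ℂ^{M×M} with entries [B̄]_{m,p} = (1/√M)·exp(i·(π·κ_m·θ_p + c·κ_m²)) for m, p ∈ {1, …, M}, where κ_m = (2m − M − 1)/2 and θ_p = (2p − M − 1)/M. Then B̄ᴴ B̄ = I_M, i.e., B̄ is unitary. -/
open scoped BigOperators Real

/-- `κ_m = (2m - M - 1)/2` for `m = 1, …, M` (here indexed by `m : Fin M`, so `m+1` plays
the role of the paper's `m`). -/
noncomputable def kappa (M : ℕ) (m : Fin M) : ℝ :=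
  (2 * ((m : ℝ) + 1) - M - 1) / 2

/-- `θ_p = (2p - M - 1)/M` for `p = 1, …, M`. -/
noncomputable def theta (M : ℕ) (p : Fin M) : ℝ :=
  (2 * ((p : ℝ) + 1) - M - 1) / M

/-- The fixed-distance-ring sampled array response matrix
`[B̄]_{m,p} = (1/√M)·exp(i·(π·κ_m·θ_p + c·κ_m²))`. -/
noncomputable def Bbar (M : ℕ) (c : ℝ) : Matrix (Fin M) (Fin M) ℂ :=
  Matrix.of fun m p =>
    (1 / Real.sqrt M : ℝ) *
      Complex.exp (Complex.I * ((π * kappa M m * theta M p + c * kappa M m ^ 2 : ℝ) : ℂ))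

/-- Product of two entries on the same distance ring: the quadratic phases cancel. -/
theorem entry_mul (M : ℕ) (hM : 0 < M) (c : ℝ) (m p q : Fin M) :
    star (Bbar M c m p) * Bbar M c m q =
      (1 / (M : ℂ)) * (Complex.exp (-(Complex.I * π * ((M : ℂ) - 1) * ((q : ℂ) - (p : ℂ)) / M)) *
        Complex.exp (2 * π * Complex.I * ((q : ℂ) - (p : ℂ)) / M) ^ (m : ℕ)) := by
  have hM0 : (M : ℂ) ≠ 0 := by exact_mod_cast hM.ne'
  have hs : ((1 / Real.sqrt M : ℝ) : ℂ) * ((1 / Real.sqrt M : ℝ) : ℂ) = 1 / (M : ℂ) := by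
    rw [← Complex.ofReal_mul, div_mul_div_comm, Real.mul_self_sqrt (Nat.cast_nonneg M)]
    push_cast
    ring
  simp only [Bbar, Matrix.of_apply]
  rw [star_mul', Complex.star_def, Complex.conj_ofReal, ← Complex.exp_conj,
    mul_mul_mul_comm, hs, ← Complex.exp_add, ← Complex.exp_nat_mul, ← Complex.exp_add]
  congr 2
  rw [map_mul, Complex.conj_I, Complex.conj_ofReal]
  simp only [kappa, theta]
  push_cast
  field_simp
  ring

theorem stmt_5 (M : ℕ) (hM : 0 < M) (c : ℝ) :
    (Bbar M c).conjTranspose * Bbar M c = 1 := by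
  have hM0 : (M : ℂ) ≠ 0 := by exact_mod_cast hM.ne'
  ext p q
  rw [Matrix.mul_apply]
  simp only [Matrix.conjTranspose_apply]
  rw [Finset.sum_congr rfl (fun m _ => entry_mul M hM c m p q), ← Finset.mul_sum,
    ← Finset.mul_sum]
  by_cases h : p = q
  · subst h
    simp [hM0]
  · rw [Matrix.one_apply_ne h]
    set z := Complex.exp (2 * π * Complex.I * ((q : ℂ) - (p : ℂ)) / M) with hz
    have hzM : z ^ M = 1 := by
      rw [hz, ← Complex.exp_nat_mul, Complex.exp_eq_one_iff]
      refine ⟨(q : ℤ) - (p : ℤ), ?_⟩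
      push_cast
      field_simp
    have hz1 : z ≠ 1 := by
      rw [hz, Ne, Complex.exp_eq_one_iff]
      rintro ⟨n, hn⟩
      have h2 : ((q : ℂ) - (p : ℂ)) = n * M := by
        have hpi := Complex.two_pi_I_ne_zero
        rw [div_eq_iff hM0] at hn
        apply mul_left_cancel₀ hpi
        rw [hn]
        ring
      have h3 : ((q : ℤ) - (p : ℤ)) = n * M := by exact_mod_cast h2
      have hlt : |((q : ℤ) - (p : ℤ))| < M := by
        have := p.2
        have := q.2
        rw [abs_lt]
        omega
      have h4 := Int.eq_zero_of_abs_lt_dvd (Dvd.intro_left n h3.symm) hlt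
      exact h (Fin.ext (by omega))
    have hsum : ∑ m : Fin M, z ^ (m : ℕ) = 0 := by
      rw [Fin.sum_univ_eq_sum_range (fun k => z ^ k), geom_sum_eq hz1, hzM]
      simp
    rw [hsum]
    simp
end
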